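/- arXiv:1101.5442 — 4 statements merged into one kernel-verified Lean document; each statement's English description precedes it below -/
import Mathlib

section
/- In any Heyting algebra, ¬¬(¬a ⇨ ¬b) = ¬(¬a ⊓ b) for all elements a, b. (This is the algebraic form of item 7 of the paper's Lemma 1: the intuitionistic equivalence ¬¬(¬A → ¬B) ↔ ¬(¬A ∧ B), used in the simplification r₂ step for implication leading from Kolmogorov's to Krivine's translation.) -/
theorem kolmogorov_lemma1_item7 {α : Type*} [HeytingAlgebra α] (a b : α) :
    (aᶜ ⇨ bᶜ)ᶜᶜ = (aᶜ ⊓ b)ᶜ := by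
  have h : aᶜ ⇨ bᶜ = (aᶜ ⊓ b)ᶜ := by
    rw [← himp_bot b, himp_himp, himp_bot, inf_comm]
  rw [h, compl_compl_compl]
end

section
/- In any Heyting algebra, ¬¬(¬¬a ⊔ ¬¬b) = (¬¬¬a ⇨ ¬¬b) for all elements a, b. (This is the algebraic form of item 10 of the paper's Lemma 1: the intuitionistic equivalence ¬¬(¬¬A ∨ ¬¬B) ↔ (¬¬¬A → ¬¬B), used in the simplification r₃ step for disjunction that produces the new translation (·)^G, a variant of Gödel–Gentzen introducing only one negation at disjunctions.) -/
theorem kolmogorov_lemma1_item10 {α : Type*} [HeytingAlgebra α] (a b : α) :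
    (aᶜᶜ ⊔ bᶜᶜ)ᶜᶜ = aᶜᶜᶜ ⇨ bᶜᶜ := by
  rw [compl_sup, compl_compl_compl, compl_compl_compl, ← himp_bot (aᶜ ⊓ bᶜ), ← himp_bot bᶜ,
    himp_himp]
end

section
/- There exists a sequence (f n) of open sets of the real line (elements of the frame of open subsets of ℝ) such that ¬¬(⨅ n, ¬¬ f n) ≠ ¬¬(⨅ n, f n), where the infimum of a family of opens is the interior of their intersection and ¬u is the interior of the complement of u. (This witnesses item 17 of the paper's Lemma 1: the equivalence ¬¬∀x ¬¬A ↔ ¬¬∀x A, though provable classically, is not provable intuitionistically; concretely one may take f n = ℝ \ {q n} for an enumeration (q n) of the rationals.) -/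
open TopologicalSpace in
theorem TopologicalSpace.Opens.compl_eq_bot_of_dense {X : Type*} [TopologicalSpace X]
    {U : Opens X} (hU : Dense (U : Set X)) : Uᶜ = ⊥ := by
  apply Opens.ext
  rw [Opens.coe_compl_eq_interior_compl, hU.interior_compl, Opens.coe_bot]

open TopologicalSpace in
theorem TopologicalSpace.Opens.iInf_eq_bot_of_denseRange {X ι : Type*} [TopologicalSpace X]
    {q : ι → X} (hq : DenseRange q) {f : ι → Opens X} (hf : ∀ i, q i ∉ f i) : ⨅ i, f i = ⊥ := by
  rw [← Opens.not_nonempty_iff_eq_bot]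
  intro hne
  obtain ⟨i, hi⟩ := hq.exists_mem_open (⨅ i, f i).isOpen hne
  exact hf i (iInf_le f i hi)

theorem kolmogorov_lemma1_item17_fails :
    ∃ f : ℕ → TopologicalSpace.Opens ℝ, (⨅ n, (f n)ᶜᶜ)ᶜᶜ ≠ (⨅ n, f n)ᶜᶜ := by
  let q := TopologicalSpace.denseSeq ℝ
  let f (n : ℕ) : TopologicalSpace.Opens ℝ := ⟨{q n}ᶜ, isOpen_compl_singleton⟩
  have hinf : ⨅ n, f n = ⊥ := TopologicalSpace.Opens.iInf_eq_bot_of_denseRange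
    (TopologicalSpace.denseRange_denseSeq ℝ) fun n (hn : q n ∈ ({q n}ᶜ : Set ℝ)) => hn rfl
  have hcompl (n : ℕ) : (f n)ᶜ = ⊥ :=
    TopologicalSpace.Opens.compl_eq_bot_of_dense (dense_compl_singleton (q n))
  refine ⟨f, ?_⟩
  simp [hinf, hcompl]
end

section
/- There exists a sequence (f n) of open sets of the real line (elements of the frame of open subsets of ℝ) such that ¬¬(⨆ n, ¬¬ f n) ≠ ⨆ n, ¬¬ f n, where the supremum of a family of opens is their union and ¬u is the interior of the complement of u. (This witnesses item 20 of the paper's Lemma 1: the equivalence ¬¬∃x ¬¬A ↔ ∃x ¬¬A, though provable classically, is not provable intuitionistically; concretely one may take f n = (−∞, −1/(n+1)) ∪ (1/(n+1), ∞).) -/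
open TopologicalSpace

/-- If the union of a family of open sets is the complement of a non-isolated point, then
it is not regular. -/
theorem compl_compl_iSup_ne_of_coe_iSup_eq {X : Type*} [TopologicalSpace X] {a : X}
    (ha : interior ({a} : Set X) = ∅) {ι : Sort*} {f : ι → Opens X}
    (hf : ((⨆ i, f i : Opens X) : Set X) = {a}ᶜ) : (⨆ i, f i)ᶜᶜ ≠ ⨆ i, f i := by
  intro h
  have hbot : (⨆ i, f i)ᶜ = ⊥ := by
    apply Opens.ext
    rw [Opens.coe_compl_eq_interior_compl, hf, compl_compl, ha, Opens.coe_bot]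
  rw [hbot, compl_bot] at h
  rw [← h, Opens.coe_top] at hf
  exact (hf ▸ Set.mem_univ a : a ∈ ({a}ᶜ : Set X)) rfl

/-- The exteriors of the balls of radius `1 / (n + 1)` around `a` cover everything but `a`. -/
theorem coe_iSup_compl_ball {X : Type*} [MetricSpace X] (a : X) :
    ((⨆ n : ℕ, (⟨Metric.ball a (1 / (n + 1)), Metric.isOpen_ball⟩ : Opens X)ᶜ : Opens X) : Set X)
      = {a}ᶜ := by
  ext x
  simp only [Opens.coe_iSup, Opens.coe_compl_eq_interior_compl, Opens.coe_mk, Set.mem_iUnion,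
    Set.mem_compl_iff, Set.mem_singleton_iff]
  constructor
  · rintro ⟨n, hx⟩ rfl
    exact interior_subset hx (Metric.mem_ball_self Nat.one_div_pos_of_nat)
  · intro hx
    obtain ⟨n, hn⟩ := exists_nat_one_div_lt (dist_pos.2 hx)
    refine ⟨n, interior_maximal (Set.compl_subset_compl.2 Metric.ball_subset_closedBall)
      Metric.isClosed_closedBall.isOpen_compl ?_⟩
    simpa using hn

theorem kolmogorov_lemma1_item20_fails :
    ∃ f : ℕ → TopologicalSpace.Opens ℝ, (⨆ n, (f n)ᶜᶜ)ᶜᶜ ≠ ⨆ n, (f n)ᶜᶜ := by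
  refine ⟨fun n => (⟨Metric.ball 0 (1 / (n + 1)), Metric.isOpen_ball⟩ : Opens ℝ)ᶜ, ?_⟩
  simp only [compl_compl_compl]
  exact compl_compl_iSup_ne_of_coe_iSup_eq (interior_singleton 0) (coe_iSup_compl_ball 0)
end
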